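/- arXiv:2312.12886 — 2 statements merged into one kernel-verified Lean document; each statement's English description precedes it below -/
import Mathlib

section
/- (Key entropy inequality for the quadratic entropy.) Let T > 0, η > 0, let V ∈ C¹(ℝ) be nondecreasing, and let q ∈ W^{1,∞}(Ω_T) be a strong solution of the nonlocal conservation law ∂_t q + ∂_x(V(W)q) = 0 with exponential kernel γ_η, where W := W[q,γ_η] and q₀ := q(0,·). Set G(y) := ∫_0^y sV(s) ds. Then for α(x) := x²/2 and every nonnegative φ ∈ C¹_c([0,T)×ℝ): ℰ[φ,α,q] ≥ −∬_{Ω_T}(G(|q|) − G(W))∂_xφ dx dt + (1/2)∬_{Ω_T}(q² − W²)V(W)∂_xφ dx dt + ∬_{Ω_T} q²(V(|q|) − V(W))∂_xφ dx dt. -/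
open MeasureTheory Set Filter Function

noncomputable section

/-- The nonlocal term `W[q,γ](t,x) = ∫_{-∞}^x γ(y-x) |q(t,y)| dy`. -/
def nonlocalTerm (γ : ℝ → ℝ) (q : ℝ → ℝ → ℝ) (t x : ℝ) : ℝ :=
  ∫ y in Iic x, γ (y - x) * |q t y|

/-- The exponential kernel `γ_η(x) = exp(x/η)/η`. -/
def expKernel (η : ℝ) (x : ℝ) : ℝ := Real.exp (x / η) / η

/-- An admissible kernel: nonnegative, nondecreasing, convex, of bounded variation,
and of unit mass on `(-∞, 0]`. -/
structure AdmissibleKernel (γ : ℝ → ℝ) : Prop where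
  nonneg : ∀ x ≤ (0:ℝ), 0 ≤ γ x
  mono : MonotoneOn γ (Iic (0:ℝ))
  convex : ConvexOn ℝ (Iic (0:ℝ)) γ
  bv : BoundedVariationOn γ (Iic (0:ℝ))
  mass : (∫ x in Iic (0:ℝ), γ x) = 1

/-- A test function in `C¹_c([0,T) × ℝ)`. -/
structure IsTestFun (T : ℝ) (φ : ℝ → ℝ → ℝ) : Prop where
  smooth : ContDiff ℝ 1 (uncurry φ)
  compSupp : HasCompactSupport (uncurry φ)
  vanish : ∀ t x : ℝ, T ≤ t → φ t x = 0

/-- Membership in `C([0,T]; L¹_loc(ℝ)) ∩ L^∞(Ω_T)`. -/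
structure InSolutionClass (T : ℝ) (q : ℝ → ℝ → ℝ) : Prop where
  meas : Measurable (uncurry q)
  bdd : ∃ M : ℝ, ∀ t x : ℝ, |q t x| ≤ M
  timeCont : ∀ s ∈ Icc (0:ℝ) T, ∀ K : Set ℝ, IsCompact K →
    Tendsto (fun t => ∫ x in K, |q t x - q s x|) (nhdsWithin s (Icc (0:ℝ) T)) (nhds 0)

/-- Weak solution of the nonlocal conservation law
`∂ₜ q + ∂ₓ (V(W[q,γ]) q) = 0`, `q(0,·) = q₀`. -/
def IsWeakSolutionNonlocal (T : ℝ) (V γ q₀ : ℝ → ℝ) (q : ℝ → ℝ → ℝ) : Prop :=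
  ∀ φ : ℝ → ℝ → ℝ, IsTestFun T φ →
    (∫ t in Ioo (0:ℝ) T, ∫ x : ℝ, q t x *
        (deriv (fun s => φ s x) t + deriv (fun y => φ t y) x * V (nonlocalTerm γ q t x)))
      + (∫ x : ℝ, φ 0 x * q₀ x) = 0

/-- Strong solution: Lipschitz on `[0,T] × ℝ` and the PDE holds pointwise a.e. in `Ω_T`. -/
def IsStrongSolutionNonlocal (T : ℝ) (V γ q₀ : ℝ → ℝ) (q : ℝ → ℝ → ℝ) : Prop :=
  (∃ L : NNReal, LipschitzOnWith L (uncurry q) (Icc (0:ℝ) T ×ˢ (univ : Set ℝ))) ∧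
  (∀ x : ℝ, q 0 x = q₀ x) ∧
  (∀ᵐ p : ℝ × ℝ ∂(volume.restrict (Ioo (0:ℝ) T ×ˢ (univ : Set ℝ))),
    deriv (fun s => q s p.2) p.1
      + deriv (fun y => V (nonlocalTerm γ q p.1 y) * q p.1 y) p.2 = 0)

/-- The entropy functional `ℰ[φ,α,q]` (with entropy flux `β`). -/
def entropyE (T : ℝ) (q₀ : ℝ → ℝ) (α β : ℝ → ℝ) (φ : ℝ → ℝ → ℝ) (q : ℝ → ℝ → ℝ) : ℝ :=
  (∫ t in Ioo (0:ℝ) T, ∫ x : ℝ,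
      α (q t x) * deriv (fun s => φ s x) t + β (q t x) * deriv (fun y => φ t y) x)
    + ∫ x : ℝ, α (q₀ x) * φ 0 x

/-- Weak solution of the local conservation law `∂ₜ q + ∂ₓ (V(|q|) q) = 0`. -/
def IsWeakSolutionLocal (T : ℝ) (V q₀ : ℝ → ℝ) (q : ℝ → ℝ → ℝ) : Prop :=
  ∀ φ : ℝ → ℝ → ℝ, IsTestFun T φ →
    (∫ t in Ioo (0:ℝ) T, ∫ x : ℝ, q t x *
        (deriv (fun s => φ s x) t + deriv (fun y => φ t y) x * V |q t x|))
      + (∫ x : ℝ, φ 0 x * q₀ x) = 0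

/-- Entropy solution of the local conservation law. -/
def IsEntropySolutionLocal (T : ℝ) (V q₀ : ℝ → ℝ) (q : ℝ → ℝ → ℝ) : Prop :=
  ∀ α β : ℝ → ℝ, ContDiff ℝ 2 α → ConvexOn ℝ univ α → ContDiff ℝ 1 β →
    (∀ x : ℝ, deriv β x = deriv α x * deriv (fun y => y * V |y|) x) →
    ∀ φ : ℝ → ℝ → ℝ, IsTestFun T φ → (∀ t x : ℝ, 0 ≤ φ t x) →
      0 ≤ entropyE T q₀ α β φ q


lemma integrableOn_exp_mul_abs_Iic {η : ℝ} (hη : 0 < η) {g : ℝ → ℝ} {L : NNReal}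
    (hg : LipschitzWith L g) (c : ℝ) :
    IntegrableOn (fun y => Real.exp (y / η) * |g y|) (Iic c) := by
  have h1 : IntegrableOn (fun y : ℝ => Real.exp (η⁻¹ * y)) (Iic c) :=
    integrableOn_exp_mul_Iic (by positivity) c
  have h2 : IntegrableOn (fun y : ℝ => Real.exp ((2 * η)⁻¹ * y)) (Iic c) :=
    integrableOn_exp_mul_Iic (by positivity) c
  have hgc := hg.continuous
  refine ((h1.const_mul (|g c|)).add
    (h2.const_mul (L * (2 * η) * Real.exp ((2 * η)⁻¹ * c)))).mono' ?_ ?_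
  · exact (by fun_prop : Continuous fun y => Real.exp (y / η) * |g y|).aestronglyMeasurable
  · filter_upwards [ae_restrict_mem measurableSet_Iic] with y hy
    have hy' : y ≤ c := hy
    have hd : |g y| ≤ |g c| + L * (c - y) := by
      have h := hg.dist_le_mul y c
      rw [Real.dist_eq, Real.dist_eq, abs_sub_comm y c, abs_of_nonneg (sub_nonneg.2 hy')] at h
      have := abs_sub_abs_le_abs_sub (g y) (g c)
      linarith
    have he : (c - y) ≤ (2 * η) * Real.exp ((2 * η)⁻¹ * (c - y)) := by
      have h := Real.add_one_le_exp ((2 * η)⁻¹ * (c - y))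
      have h3 : (2 * η) * ((2 * η)⁻¹ * (c - y)) ≤ (2 * η) * Real.exp ((2 * η)⁻¹ * (c - y)) := by
        gcongr
        linarith
      rwa [mul_inv_cancel_left₀ (by positivity)] at h3
    have hsplit : Real.exp ((2 * η)⁻¹ * (c - y)) * Real.exp (η⁻¹ * y)
        = Real.exp ((2 * η)⁻¹ * c) * Real.exp ((2 * η)⁻¹ * y) := by
      rw [← Real.exp_add, ← Real.exp_add]
      congr 1
      field_simp
      ring
    rw [Real.norm_of_nonneg (by positivity), div_eq_inv_mul]
    simp only [Pi.add_apply]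
    calc Real.exp (η⁻¹ * y) * |g y|
        ≤ Real.exp (η⁻¹ * y) *
          (|g c| + L * ((2 * η) * Real.exp ((2 * η)⁻¹ * (c - y)))) := by
            gcongr
            exact hd.trans (by gcongr)
      _ = |g c| * Real.exp (η⁻¹ * y) + L * (2 * η) *
          (Real.exp ((2 * η)⁻¹ * (c - y)) * Real.exp (η⁻¹ * y)) := by ring
      _ = _ := by rw [hsplit]; ring

lemma nonlocalTerm_expKernel_eq (η : ℝ) (q : ℝ → ℝ → ℝ) (t x : ℝ) :
    nonlocalTerm (expKernel η) q t x =
      Real.exp (-x / η) / η * ∫ y in Iic x, Real.exp (y / η) * |q t y| := by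
  unfold nonlocalTerm expKernel
  rw [← integral_const_mul]
  congr 1 with y
  rw [sub_div, sub_eq_add_neg, Real.exp_add, neg_div]
  ring

lemma nonlocalTerm_expKernel_nonneg {η : ℝ} (hη : 0 < η) (q : ℝ → ℝ → ℝ) (t x : ℝ) :
    0 ≤ nonlocalTerm (expKernel η) q t x := by
  unfold nonlocalTerm expKernel
  exact integral_nonneg fun y => by positivity

/-- For the exponential kernel, the nonlocal term solves `∂ₓ W = (|q| - W) / η`. -/
lemma hasDerivAt_nonlocalTerm_expKernel {η : ℝ} (hη : 0 < η) {q : ℝ → ℝ → ℝ} {t : ℝ}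
    {L : NNReal} (hg : LipschitzWith L (q t)) (x : ℝ) :
    HasDerivAt (nonlocalTerm (expKernel η) q t)
      ((|q t x| - nonlocalTerm (expKernel η) q t x) / η) x := by
  have hgc := hg.continuous
  have hc : Continuous fun y => Real.exp (y / η) * |q t y| := by fun_prop
  have hI := integrableOn_exp_mul_abs_Iic hη hg
  have hprim : HasDerivAt (fun x => ∫ y in Iic x, Real.exp (y / η) * |q t y|)
      (Real.exp (x / η) * |q t x|) x := by
    have h := (intervalIntegral.integral_hasDerivAt_right (hc.intervalIntegrable 0 x)
      (hc.stronglyMeasurableAtFilter _ _) hc.continuousAt).const_add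
      (∫ y in Iic 0, Real.exp (y / η) * |q t y|)
    refine h.congr_of_eventuallyEq (Eventually.of_forall fun z => ?_)
    dsimp only
    rw [← intervalIntegral.integral_Iic_sub_Iic (hI 0) (hI z)]
    ring
  have hexp : HasDerivAt (fun x : ℝ => Real.exp (-x / η) / η)
      (Real.exp (-x / η) * (-1 / η) / η) x :=
    (((hasDerivAt_id x).neg.div_const η).exp).div_const η
  have hEq : nonlocalTerm (expKernel η) q t =
      fun x => Real.exp (-x / η) / η * ∫ y in Iic x, Real.exp (y / η) * |q t y| :=
    funext fun x => nonlocalTerm_expKernel_eq η q t x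
  rw [hEq]
  refine (hexp.mul hprim).congr_deriv ?_
  have h1 : Real.exp (-x / η) * Real.exp (x / η) = 1 := by
    rw [← Real.exp_add, neg_div, neg_add_cancel, Real.exp_zero]
  have h2 : Real.exp (-x / η) / η * (Real.exp (x / η) * |q t x|) = |q t x| / η := by
    rw [← mul_assoc, div_mul_eq_mul_div, h1]
    ring
  rw [h2]
  ring

lemma nonlocalTerm_eq_integral_Iic_zero (γ : ℝ → ℝ) (q : ℝ → ℝ → ℝ) (t x : ℝ) :
    nonlocalTerm γ q t x = ∫ z in Iic (0:ℝ), γ z * |q t (z + x)| := by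
  unfold nonlocalTerm
  have h := (measurePreserving_add_right (volume : Measure ℝ) x).setIntegral_preimage_emb
    (measurableEmbedding_addRight x) (fun y => γ (y - x) * |q t y|) (Iic x)
  rw [← h]
  simp

lemma continuous_nonlocalTerm_expKernel {η : ℝ} (hη : 0 < η) {q : ℝ → ℝ → ℝ} {L : NNReal}
    (hq : LipschitzWith L (uncurry q)) :
    Continuous (uncurry (nonlocalTerm (expKernel η) q)) := by
  have hslice (t x : ℝ) : LipschitzWith L fun z => q t (z + x) :=
    LipschitzWith.of_dist_le_mul fun a b => by
      simpa [Prod.dist_eq] using hq.dist_le_mul (t, a + x) (t, b + x)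
  have hI (t x : ℝ) : IntegrableOn (fun z => expKernel η z * |q t (z + x)|) (Iic 0) := by
    have h := (integrableOn_exp_mul_abs_Iic hη (hslice t x) 0).div_const η
    refine h.congr (Eventually.of_forall fun z => ?_)
    simp only [expKernel]
    ring
  have hK : IntegrableOn (expKernel η) (Iic 0) := by
    have h := (integrableOn_exp_mul_Iic (inv_pos.2 hη) 0).div_const η
    refine h.congr (Eventually.of_forall fun z => ?_)
    simp only [expKernel]
    rw [div_eq_inv_mul z]
  have hK0 (z : ℝ) : 0 ≤ expKernel η z := by unfold expKernel; positivity
  refine (LipschitzWith.of_dist_le_mul (K := (∫ z in Iic 0, expKernel η z).toNNReal * L)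
    fun p r => ?_).continuous
  simp only [uncurry, nonlocalTerm_eq_integral_Iic_zero]
  rw [Real.dist_eq, ← integral_sub (hI _ _) (hI _ _), NNReal.coe_mul,
    Real.coe_toNNReal _ (integral_nonneg hK0), mul_assoc, ← integral_mul_const,
    ← Real.norm_eq_abs]
  refine norm_integral_le_of_norm_le (hK.mul_const _) (Eventually.of_forall fun z => ?_)
  rw [← mul_sub, norm_mul, Real.norm_of_nonneg (hK0 z)]
  refine mul_le_mul_of_nonneg_left ?_ (hK0 z)
  refine (abs_abs_sub_abs_le_abs_sub _ _).trans ?_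
  simpa [Prod.dist_eq, Real.dist_eq] using hq.dist_le_mul (p.1, z + p.2) (r.1, z + r.2)

/-- The quadratic entropy flux associated with `f(x) = x V(|x|)`. -/
lemma quadratic_entropy_flux_eq {V G β : ℝ → ℝ} (hV : ContDiff ℝ 1 V)
    (hG : ∀ y, HasDerivAt G (y * V y) y) (hG0 : G 0 = 0) (hβC1 : ContDiff ℝ 1 β)
    (hβ : ∀ x : ℝ, deriv β x =
      deriv (fun y : ℝ => y ^ 2 / 2) x * deriv (fun y : ℝ => y * V |y|) x) (x : ℝ) :
    β x = x ^ 2 * V |x| - G |x| + β 0 := by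
  have hVd (y : ℝ) : HasDerivAt V (deriv V y) y :=
    (hV.differentiable one_ne_zero y).hasDerivAt
  have hα (y : ℝ) : deriv (fun y : ℝ => y ^ 2 / 2) y = y := by
    have h := ((hasDerivAt_id y).pow 2).div_const 2
    have h' : HasDerivAt (fun y : ℝ => y ^ 2 / 2) y y := h.congr_deriv (by simp)
    exact h'.deriv
  have hP (y : ℝ) : HasDerivAt (fun y => y ^ 2 * V y - G y) (y * V y + y ^ 2 * deriv V y) y := by
    refine (((hasDerivAt_pow 2 y).mul (hVd y)).sub (hG y)).congr_deriv ?_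
    simp
    ring
  have hβd (y : ℝ) : HasDerivAt β (deriv β y) y :=
    (hβC1.differentiable one_ne_zero y).hasDerivAt
  have hPabs (y : ℝ) : HasDerivAt (fun y => |y| ^ 2 * V |y| - G |y|) (deriv β y) y := by
    rw [hβ, hα]
    rcases lt_trichotomy y 0 with hy | rfl | hy
    · have ha := hasDerivAt_abs_neg hy
      have h1 : HasDerivAt (fun y : ℝ => y * V |y|) (1 * V |y| + y * (deriv V |y| * (-1))) y :=
        (hasDerivAt_id y).mul ((hVd |y|).comp y ha)
      rw [h1.deriv]
      refine ((hP |y|).comp y ha).congr_deriv ?_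
      rw [abs_of_neg hy]
      ring
    · have h0 := hP 0
      rw [hasDerivAt_iff_isLittleO] at h0
      have h2 := h0.comp_tendsto (continuous_abs.tendsto' (0:ℝ) 0 abs_zero)
      rw [hasDerivAt_iff_isLittleO]
      have h3 := h2.trans_isBigO
        (Asymptotics.IsBigO.of_norm_left (g := fun x' : ℝ => x' - 0) (l := nhds 0) (by
          simpa [comp_def] using Asymptotics.isBigO_refl (fun x : ℝ => x) (nhds 0) |>.norm_left))
      simpa [comp_def] using h3
    · have ha := hasDerivAt_abs_pos hy
      have h1 : HasDerivAt (fun y : ℝ => y * V |y|) (1 * V |y| + y * (deriv V |y| * 1)) y :=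
        (hasDerivAt_id y).mul ((hVd |y|).comp y ha)
      rw [h1.deriv]
      refine ((hP |y|).comp y ha).congr_deriv ?_
      rw [abs_of_pos hy]
      ring
  have hconst := is_const_of_deriv_eq_zero
    (f := fun y => β y - (|y| ^ 2 * V |y| - G |y|))
    (fun y => ((hβd y).sub (hPabs y)).differentiableAt)
    (fun y => by rw [((hβd y).fun_sub (hPabs y)).deriv, sub_self]) x 0
  simp [hG0] at hconst
  linarith

lemma integral_deriv_eq_zero_of_absolutelyContinuous {f : ℝ → ℝ}
    (hf : ∀ a b, AbsolutelyContinuousOnInterval f a b) (hs : HasCompactSupport f) :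
    Integrable (deriv f) ∧ ∫ x, deriv f x = 0 := by
  obtain ⟨R, hR⟩ := hs.isBounded.subset_ball 0
  rw [Real.ball_eq_Ioo, zero_sub, zero_add] at hR
  have hsub : support (deriv f) ⊆ Ioc (-R) R :=
    support_deriv_subset.trans (hR.trans Ioo_subset_Ioc_self)
  have hle : -|R| ≤ |R| := by linarith [abs_nonneg R]
  have hsub' : support (deriv f) ⊆ Ioc (-|R|) |R| :=
    hsub.trans (Ioc_subset_Ioc (neg_le_neg (le_abs_self R)) (le_abs_self R))
  have hz {y : ℝ} (hy : y ∉ Ioo (-R) R) : f y = 0 := image_eq_zero_of_notMem_tsupport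
    fun h => hy (hR h)
  constructor
  · rw [← integrableOn_iff_integrable_of_support_subset hsub',
      ← intervalIntegrable_iff_integrableOn_Ioc_of_le hle]
    exact (hf _ _).intervalIntegrable_deriv
  · rw [← intervalIntegral.integral_eq_integral_of_support_subset hsub,
      (hf _ _).integral_deriv_eq_sub, hz (by simp), hz (by simp), sub_zero]

lemma LipschitzWith.absolutelyContinuousOnInterval {f : ℝ → ℝ} {L : NNReal}
    (hf : LipschitzWith L f) (a b : ℝ) : AbsolutelyContinuousOnInterval f a b :=
  hf.lipschitzOnWith.absolutelyContinuousOnInterval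

lemma ContDiff.absolutelyContinuousOnInterval {f : ℝ → ℝ} (hf : ContDiff ℝ 1 f) (a b : ℝ) :
    AbsolutelyContinuousOnInterval f a b :=
  hf.contDiffOn.absolutelyContinuousOnInterval

/-- The entropy dissipation on a time slice is nonnegative. -/
lemma integral_entropy_dissipation_nonneg {η : ℝ} (hη : 0 < η) {V G : ℝ → ℝ}
    (hV : ContDiff ℝ 1 V) (hVmono : Monotone V) (hG : ∀ y, HasDerivAt G (y * V y) y)
    {g w ψ : ℝ → ℝ} {L : NNReal} (hg : LipschitzWith L g)
    (hw : ∀ x, HasDerivAt w ((|g x| - w x) / η) x) (hw0 : ∀ x, 0 ≤ w x)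
    (hψ : ContDiff ℝ 1 ψ) (hψs : HasCompactSupport ψ) (hψ0 : ∀ x, 0 ≤ ψ x) (c : ℝ) :
    0 ≤ ∫ x, (g x * deriv (fun y => V (w y) * g y) x * ψ x
      + (c + 1 / 2 * g x ^ 2 * V (w x) - G (w x) + 1 / 2 * w x ^ 2 * V (w x)) * deriv ψ x) := by
  have hgc := hg.continuous
  have hwc : Continuous w := continuous_iff_continuousAt.2 fun x => (hw x).continuousAt
  have hw1 : ContDiff ℝ 1 w := by
    rw [contDiff_one_iff_deriv]
    refine ⟨fun x => (hw x).differentiableAt, ?_⟩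
    rw [funext fun x => (hw x).deriv]
    fun_prop
  have hG1 : ContDiff ℝ 1 G := by
    rw [contDiff_one_iff_deriv]
    refine ⟨fun x => (hG x).differentiableAt, ?_⟩
    rw [funext fun x => (hG x).deriv]
    have := hV.continuous
    fun_prop
  have hVw : ContDiff ℝ 1 fun x => 1 / 2 * V (w x) := by fun_prop
  have hK : ContDiff ℝ 1 fun x => c - G (w x) + 1 / 2 * w x ^ 2 * V (w x) := by fun_prop
  have hVd (y : ℝ) : HasDerivAt V (deriv V y) y :=
    (hV.differentiable one_ne_zero y).hasDerivAt
  have hV'c : Continuous (deriv V) := hV.continuous_deriv le_rfl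
  set F : ℝ → ℝ := fun x => ((1 / 2 * V (w x)) * (g x * g x)
    + (c - G (w x) + 1 / 2 * w x ^ 2 * V (w x))) * ψ x with hF
  have hFac (a b : ℝ) : AbsolutelyContinuousOnInterval F a b :=
    (((hVw.absolutelyContinuousOnInterval a b).fun_mul
      ((hg.absolutelyContinuousOnInterval a b).fun_mul
        (hg.absolutelyContinuousOnInterval a b))).fun_add
      (hK.absolutelyContinuousOnInterval a b)).fun_mul (hψ.absolutelyContinuousOnInterval a b)
  obtain ⟨hFi, hF0⟩ := integral_deriv_eq_zero_of_absolutelyContinuous hFac hψs.mul_left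
  set N : ℝ → ℝ := fun x =>
    (1 / (2 * η) * ((|g x| - w x) ^ 2 * (|g x| + w x)) * deriv V (w x)) * ψ x with hN
  have hNi : Integrable N := by
    have hψc := hψ.continuous
    exact Continuous.integrable_of_hasCompactSupport (by fun_prop) hψs.mul_left
  have hN0 : 0 ≤ ∫ x, N x := integral_nonneg fun x => by
    have h1 := hw0 x
    have h2 := hψ0 x
    have h3 : 0 ≤ deriv V (w x) := hVmono.deriv_nonneg
    have h4 : 0 ≤ |g x| + w x := by positivity
    exact mul_nonneg (by positivity) h2
  have key : ∀ᵐ x, (g x * deriv (fun y => V (w y) * g y) x * ψ x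
      + (c + 1 / 2 * g x ^ 2 * V (w x) - G (w x) + 1 / 2 * w x ^ 2 * V (w x)) * deriv ψ x)
      = deriv F x + N x := by
    filter_upwards [hg.ae_differentiableAt_real] with x hx
    have hgd := hx.hasDerivAt
    have hVwd : HasDerivAt (fun y => V (w y)) (deriv V (w x) * ((|g x| - w x) / η)) x :=
      (hVd (w x)).comp x (hw x)
    have hGwd : HasDerivAt (fun y => G (w y)) (w x * V (w x) * ((|g x| - w x) / η)) x :=
      (hG (w x)).comp x (hw x)
    have hψd : HasDerivAt ψ (deriv ψ x) x := (hψ.differentiable one_ne_zero x).hasDerivAt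
    have hFd := (((hVwd.const_mul (1 / 2)).fun_mul (hgd.fun_mul hgd)).fun_add
      ((hGwd.const_sub c).fun_add ((((hw x).fun_pow 2).const_mul (1 / 2)).fun_mul hVwd))).fun_mul hψd
    rw [(hVwd.fun_mul hgd).deriv, hF, hFd.deriv, hN]
    have habs : |g x| ^ 2 = g x ^ 2 := sq_abs _
    have hN' : 1 / (2 * η) * ((|g x| - w x) ^ 2 * (|g x| + w x)) * deriv V (w x)
        = 1 / 2 * ((g x ^ 2 - w x ^ 2) * (deriv V (w x) * ((|g x| - w x) / η))) := by
      rw [← habs]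
      field_simp
      ring
    dsimp only
    rw [hN']
    push_cast
    ring
  rw [integral_congr_ae key, integral_add hFi hNi, hF0, zero_add]
  exact hN0

/-- Integration by parts in time against a function vanishing at the final time. -/
lemma setIntegral_half_sq_mul_deriv {T : ℝ} (hT : 0 < T) {u ψ : ℝ → ℝ} {L : NNReal}
    (hu : LipschitzWith L u) (hψ : ContDiff ℝ 1 ψ) (hψT : ψ T = 0) :
    ∫ t in Ioo 0 T, u t ^ 2 / 2 * deriv ψ t =
      -(u 0 ^ 2 / 2 * ψ 0) - ∫ t in Ioo 0 T, u t * deriv u t * ψ t := by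
  have hac : AbsolutelyContinuousOnInterval (fun t => 1 / 2 * (u t * u t)) 0 T :=
    ((hu.absolutelyContinuousOnInterval 0 T).fun_mul
      (hu.absolutelyContinuousOnInterval 0 T)).const_mul _
  have h := hac.integral_mul_deriv_eq_deriv_mul (hψ.absolutelyContinuousOnInterval 0 T)
  have h' : ∫ t in (0:ℝ)..T, deriv (fun t => 1 / 2 * (u t * u t)) t * ψ t
      = ∫ t in (0:ℝ)..T, u t * deriv u t * ψ t := by
    refine intervalIntegral.integral_congr_ae ?_
    filter_upwards [hu.ae_differentiableAt_real] with t ht _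
    rw [((ht.hasDerivAt.fun_mul ht.hasDerivAt).const_mul (1 / 2)).deriv]
    ring
  rw [h', intervalIntegral.integral_of_le hT.le, intervalIntegral.integral_of_le hT.le,
    integral_Ioc_eq_integral_Ioo, integral_Ioc_eq_integral_Ioo, hψT] at h
  have h'' : ∫ t in Ioo 0 T, u t ^ 2 / 2 * deriv ψ t
      = ∫ t in Ioo 0 T, 1 / 2 * (u t * u t) * deriv ψ t := by
    congr 1 with t
    ring
  rw [h'', h]
  ring

section TestFunctions

variable {T : ℝ} {φ : ℝ → ℝ → ℝ}

lemma IsTestFun.hasDerivAt_fst (hφ : IsTestFun T φ) (t x : ℝ) :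
    HasDerivAt (fun s => φ s x) (fderiv ℝ (uncurry φ) (t, x) (1, 0)) t :=
  (hφ.smooth.differentiable one_ne_zero (t, x)).hasFDerivAt.comp_hasDerivAt (f := fun s => (s, x)) t
    ((hasDerivAt_id t).prodMk (hasDerivAt_const t x))

lemma IsTestFun.hasDerivAt_snd (hφ : IsTestFun T φ) (t x : ℝ) :
    HasDerivAt (fun y => φ t y) (fderiv ℝ (uncurry φ) (t, x) (0, 1)) x :=
  (hφ.smooth.differentiable one_ne_zero (t, x)).hasFDerivAt.comp_hasDerivAt (f := fun y => (t, y)) x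
    ((hasDerivAt_const x t).prodMk (hasDerivAt_id x))

lemma IsTestFun.continuous_fderiv_apply (hφ : IsTestFun T φ) (v : ℝ × ℝ) :
    Continuous fun p => fderiv ℝ (uncurry φ) p v :=
  (hφ.smooth.continuous_fderiv one_ne_zero).clm_apply continuous_const

lemma IsTestFun.contDiff_left (hφ : IsTestFun T φ) (x : ℝ) : ContDiff ℝ 1 fun s => φ s x :=
  hφ.smooth.comp (contDiff_id.prodMk contDiff_const)

lemma IsTestFun.contDiff_right (hφ : IsTestFun T φ) (t : ℝ) : ContDiff ℝ 1 fun y => φ t y :=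
  hφ.smooth.comp (contDiff_const.prodMk contDiff_id)

lemma IsTestFun.hasCompactSupport_right (hφ : IsTestFun T φ) (t : ℝ) :
    HasCompactSupport fun y => φ t y :=
  HasCompactSupport.of_support_subset_isCompact (hφ.compSupp.isCompact.image continuous_snd)
    fun y hy => ⟨(t, y), subset_tsupport _ hy, rfl⟩

end TestFunctions

lemma quadratic_entropy_inequality_of_lipschitzWith
    {T : ℝ} (hT : 0 < T) {η : ℝ} (hη : 0 < η)
    {V : ℝ → ℝ} (hV : ContDiff ℝ 1 V) (hVmono : Monotone V)
    {q : ℝ → ℝ → ℝ} {L : NNReal} (hq : LipschitzWith L (uncurry q))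
    (hpde : ∀ᵐ p : ℝ × ℝ ∂(volume.restrict (Ioo (0:ℝ) T ×ˢ (univ : Set ℝ))),
      deriv (fun s => q s p.2) p.1
        + deriv (fun y => V (nonlocalTerm (expKernel η) q p.1 y) * q p.1 y) p.2 = 0)
    {G : ℝ → ℝ} (hG : ∀ y : ℝ, G y = ∫ s in (0:ℝ)..y, s * V s)
    {β : ℝ → ℝ} (hβC1 : ContDiff ℝ 1 β)
    (hβ : ∀ x : ℝ, deriv β x =
      deriv (fun y : ℝ => y ^ 2 / 2) x * deriv (fun y : ℝ => y * V |y|) x)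
    {φ : ℝ → ℝ → ℝ} (hφ : IsTestFun T φ) (hφ0 : ∀ t x : ℝ, 0 ≤ φ t x) :
    entropyE T (fun x => q 0 x) (fun x => x ^ 2 / 2) β φ q ≥
      -(∫ t in Ioo (0:ℝ) T, ∫ x : ℝ,
          (G |q t x| - G (nonlocalTerm (expKernel η) q t x)) *
            deriv (fun y => φ t y) x)
      + (1 / 2) * (∫ t in Ioo (0:ℝ) T, ∫ x : ℝ,
          (q t x ^ 2 - nonlocalTerm (expKernel η) q t x ^ 2) *
            V (nonlocalTerm (expKernel η) q t x) * deriv (fun y => φ t y) x)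
      + (∫ t in Ioo (0:ℝ) T, ∫ x : ℝ,
          q t x ^ 2 * (V |q t x| - V (nonlocalTerm (expKernel η) q t x)) *
            deriv (fun y => φ t y) x) := by
  have hVc := hV.continuous
  have hGd (y : ℝ) : HasDerivAt G (y * V y) y := by
    have hc : Continuous fun s => s * V s := by fun_prop
    rw [funext hG]
    exact intervalIntegral.integral_hasDerivAt_right (hc.intervalIntegrable 0 y)
      (hc.stronglyMeasurableAtFilter _ _) hc.continuousAt
  have hGc : Continuous G := continuous_iff_continuousAt.2 fun y => (hGd y).continuousAt
  have hβc := hβC1.continuous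
  have hflux := quadratic_entropy_flux_eq hV hGd (by simp [hG]) hβC1 hβ
  have hqx (t : ℝ) : LipschitzWith L (q t) := LipschitzWith.of_dist_le_mul fun a b => by
    simpa [Prod.dist_eq] using hq.dist_le_mul (t, a) (t, b)
  have hqt (x : ℝ) : LipschitzWith L fun s => q s x := LipschitzWith.of_dist_le_mul fun a b => by
    simpa [Prod.dist_eq] using hq.dist_le_mul (a, x) (b, x)
  have hqc : Continuous fun p : ℝ × ℝ => q p.1 p.2 := hq.continuous
  set W := nonlocalTerm (expKernel η) q
  have hWc : Continuous fun p : ℝ × ℝ => W p.1 p.2 := continuous_nonlocalTerm_expKernel hη hq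
  have hφc : Continuous fun p : ℝ × ℝ => φ p.1 p.2 := hφ.smooth.continuous
  have hsupp (v : ℝ × ℝ) : HasCompactSupport fun p => fderiv ℝ (uncurry φ) p v :=
    hφ.compSupp.fderiv_apply ℝ v
  have hDc := hφ.continuous_fderiv_apply
  unfold entropyE
  simp only [(hφ.hasDerivAt_fst _ _).deriv, (hφ.hasDerivAt_snd _ _).deriv]
  set φt : ℝ × ℝ → ℝ := fun p => fderiv ℝ (uncurry φ) p (1, 0)
  set φx : ℝ × ℝ → ℝ := fun p => fderiv ℝ (uncurry φ) p (0, 1)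
  have hφtc : Continuous φt := hDc _
  have hφxc : Continuous φx := hDc _
  set μ : Measure ℝ := volume.restrict (Ioo (0:ℝ) T)
  have hint {f ψ : ℝ × ℝ → ℝ} (hf : Continuous f) (hψ : Continuous ψ)
      (hs : HasCompactSupport ψ) : Integrable (fun p => f p * ψ p) (μ.prod volume) :=
    (hf.mul hψ).integrable_of_hasCompactSupport hs.mul_left
  have hA1 := hint (f := fun p => q p.1 p.2 ^ 2 / 2) (by fun_prop) hφtc (hsupp _)
  have hA2 := hint (f := fun p => β (q p.1 p.2)) (by fun_prop) hφxc (hsupp _)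
  have hR1 := hint (f := fun p => G |q p.1 p.2| - G (W p.1 p.2)) (by fun_prop) hφxc (hsupp _)
  have hR2 := hint (f := fun p => (q p.1 p.2 ^ 2 - W p.1 p.2 ^ 2) * V (W p.1 p.2))
    (by fun_prop) hφxc (hsupp _)
  have hR3 := hint (f := fun p => q p.1 p.2 ^ 2 * (V |q p.1 p.2| - V (W p.1 p.2)))
    (by fun_prop) hφxc (hsupp _)
  have hB : Integrable (fun p : ℝ × ℝ => q p.1 p.2 * deriv (fun s => q s p.2) p.1 * φ p.1 p.2)
      (μ.prod volume) := by
    have hm : Measurable fun p : ℝ × ℝ => deriv (fun s => q s p.2) p.1 :=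
      (measurable_deriv_with_param (f := fun x s => q s x)
        (hqc.comp continuous_swap)).comp measurable_swap
    refine ((hint hqc hφc hφ.compSupp).norm.const_mul (L : ℝ)).mono'
      ((hqc.measurable.mul hm).mul hφc.measurable).aestronglyMeasurable
      (Eventually.of_forall fun p => ?_)
    have h := norm_deriv_le_of_lipschitz (x₀ := p.1) (hqt p.2)
    rw [norm_mul, norm_mul, norm_mul]
    calc _ = ‖deriv (fun s => q s p.2) p.1‖ * (‖q p.1 p.2‖ * ‖φ p.1 p.2‖) := by ring
      _ ≤ _ := by gcongr
  have hinit : Integrable fun x => q 0 x ^ 2 / 2 * φ 0 x := by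
    have h1 := (hqx 0).continuous
    have h2 := (hφ.contDiff_right 0).continuous
    exact Continuous.integrable_of_hasCompactSupport (by fun_prop)
      (hφ.hasCompactSupport_right 0).mul_left
  have htime : (∫ t, (∫ x, q t x ^ 2 / 2 * φt (t, x)) ∂μ) + ∫ x, q 0 x ^ 2 / 2 * φ 0 x
      = -∫ t, (∫ x, q t x * deriv (fun s => q s x) t * φ t x) ∂μ := by
    have hx (x : ℝ) : ∫ t, q t x ^ 2 / 2 * φt (t, x) ∂μ
        = -(q 0 x ^ 2 / 2 * φ 0 x) - ∫ t, q t x * deriv (fun s => q s x) t * φ t x ∂μ := by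
      have h := setIntegral_half_sq_mul_deriv hT (hqt x) (hφ.contDiff_left x)
        (hφ.vanish T x le_rfl)
      simpa only [(hφ.hasDerivAt_fst _ _).deriv] using h
    rw [integral_integral_swap hA1]
    have hsub : ∫ x, (-(q 0 x ^ 2 / 2 * φ 0 x)
          - ∫ t, q t x * deriv (fun s => q s x) t * φ t x ∂μ)
        = (∫ x, -(q 0 x ^ 2 / 2 * φ 0 x))
          - ∫ x, ∫ t, q t x * deriv (fun s => q s x) t * φ t x ∂μ :=
      integral_sub hinit.neg hB.integral_prod_right
    have hswap : ∫ t, (∫ x, q t x * deriv (fun s => q s x) t * φ t x) ∂μ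
        = ∫ x, ∫ t, q t x * deriv (fun s => q s x) t * φ t x ∂μ := integral_integral_swap hB
    simp only [hx]
    rw [hsub, integral_neg, hswap]
    ring
  have hsplit : ∫ t, (∫ x, q t x ^ 2 / 2 * φt (t, x) + β (q t x) * φx (t, x)) ∂μ
      = (∫ t, (∫ x, q t x ^ 2 / 2 * φt (t, x)) ∂μ) + ∫ t, (∫ x, β (q t x) * φx (t, x)) ∂μ :=
    integral_integral_add hA1 hA2
  have hBA := hA2.sub hB
  have hBA1 := hBA.add hR1
  have hBA2 := hBA1.sub (hR2.const_mul (1 / 2))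
  have hBA3 := hBA2.sub hR3
  have hdiss := integral_prod _ hBA3
  rw [integral_sub' hBA2 hR3, integral_sub' hBA1 (hR2.const_mul (1 / 2)), integral_add' hBA hR1,
    integral_sub' hA2 hB, integral_const_mul, integral_prod _ hA2, integral_prod _ hB,
    integral_prod _ hR1, integral_prod _ hR2, integral_prod _ hR3] at hdiss
  have hnonneg : 0 ≤ ∫ t, (∫ x, q t x * deriv (fun y => V (W t y) * q t y) x * φ t x
      + (β 0 + 1 / 2 * q t x ^ 2 * V (W t x) - G (W t x) + 1 / 2 * W t x ^ 2 * V (W t x))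
        * deriv (φ t) x) ∂μ :=
    integral_nonneg fun t => integral_entropy_dissipation_nonneg hη hV hVmono hGd (hqx t)
      (hasDerivAt_nonlocalTerm_expKernel hη (hqx t)) (nonlocalTerm_expKernel_nonneg hη q t)
      (hφ.contDiff_right t) (hφ.hasCompactSupport_right t) (hφ0 t) (β 0)
  have hpde' : ∀ᵐ t ∂μ, ∀ᵐ x, deriv (fun s => q s x) t
      + deriv (fun y => V (W t y) * q t y) x = 0 := by
    rw [Measure.volume_eq_prod, ← Measure.prod_restrict, Measure.restrict_univ] at hpde
    exact Measure.ae_ae_of_ae_prod hpde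
  rw [integral_congr_ae (hpde'.mono fun t ht => integral_congr_ae (ht.mono fun x hx => ?_))]
    at hnonneg
  · rw [← hdiss] at hnonneg
    linarith
  · have h := eq_neg_of_add_eq_zero_right hx
    have h' : deriv (φ t) x = φx (t, x) := (hφ.hasDerivAt_snd t x).deriv
    simp only [Pi.add_apply, Pi.sub_apply]
    rw [h, h', hflux (q t x)]
    ring

lemma LipschitzOnWith.comp_projIcc_fst {a b : ℝ} (hab : a ≤ b) {q : ℝ → ℝ → ℝ} {L : NNReal}
    (hq : LipschitzOnWith L (uncurry q) (Icc a b ×ˢ (univ : Set ℝ))) :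
    LipschitzWith L (uncurry fun t x => q (projIcc a b hab t) x) :=
  LipschitzWith.of_dist_le_mul fun p r => by
    refine (hq.dist_le_mul ((projIcc a b hab p.1 : ℝ), p.2) ⟨(projIcc a b hab p.1).2, trivial⟩
      ((projIcc a b hab r.1 : ℝ), r.2) ⟨(projIcc a b hab r.1).2, trivial⟩).trans ?_
    refine mul_le_mul_of_nonneg_left (max_le_max ?_ le_rfl) L.2
    simpa [Subtype.dist_eq] using (LipschitzWith.projIcc hab).dist_le_mul p.1 r.1

/-- key entropy inequality for the quadratic entropy
`α(x) = x²/2`. -/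
theorem quadratic_entropy_inequality
    (T : ℝ) (hT : 0 < T) (η : ℝ) (hη : 0 < η)
    (V : ℝ → ℝ) (hV : ContDiff ℝ 1 V) (hVmono : Monotone V)
    (q : ℝ → ℝ → ℝ)
    (hq : IsStrongSolutionNonlocal T V (expKernel η) (fun x => q 0 x) q)
    (G : ℝ → ℝ) (hG : ∀ y : ℝ, G y = ∫ s in (0:ℝ)..y, s * V s)
    (β : ℝ → ℝ) (hβC1 : ContDiff ℝ 1 β)
    (hβ : ∀ x : ℝ, deriv β x =
      deriv (fun y : ℝ => y ^ 2 / 2) x * deriv (fun y : ℝ => y * V |y|) x) :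
    ∀ φ : ℝ → ℝ → ℝ, IsTestFun T φ → (∀ t x : ℝ, 0 ≤ φ t x) →
      entropyE T (fun x => q 0 x) (fun x => x ^ 2 / 2) β φ q ≥
        -(∫ t in Ioo (0:ℝ) T, ∫ x : ℝ,
            (G |q t x| - G (nonlocalTerm (expKernel η) q t x)) *
              deriv (fun y => φ t y) x)
        + (1 / 2) * (∫ t in Ioo (0:ℝ) T, ∫ x : ℝ,
            (q t x ^ 2 - nonlocalTerm (expKernel η) q t x ^ 2) *
              V (nonlocalTerm (expKernel η) q t x) * deriv (fun y => φ t y) x)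
        + (∫ t in Ioo (0:ℝ) T, ∫ x : ℝ,
            q t x ^ 2 * (V |q t x| - V (nonlocalTerm (expKernel η) q t x)) *
              deriv (fun y => φ t y) x) := by
  intro φ hφ hφ0
  obtain ⟨⟨L, hL⟩, -, hpde⟩ := hq
  set q' : ℝ → ℝ → ℝ := fun t x => q (projIcc 0 T hT.le t) x with hq'
  have hqq {t : ℝ} (ht : t ∈ Icc 0 T) : q' t = q t := by
    funext x
    simp only [hq', projIcc_of_mem hT.le ht]
  have hWW {t : ℝ} (ht : t ∈ Icc 0 T) :
      nonlocalTerm (expKernel η) q' t = nonlocalTerm (expKernel η) q t := by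
    funext x
    simp only [nonlocalTerm, hqq ht]
  have hpde' : ∀ᵐ p : ℝ × ℝ ∂(volume.restrict (Ioo (0:ℝ) T ×ˢ (univ : Set ℝ))),
      deriv (fun s => q' s p.2) p.1
        + deriv (fun y => V (nonlocalTerm (expKernel η) q' p.1 y) * q' p.1 y) p.2 = 0 := by
    filter_upwards [hpde, ae_restrict_mem (measurableSet_Ioo.prod MeasurableSet.univ)]
      with p hp hpm
    have hloc : (fun s => q' s p.2) =ᶠ[nhds p.1] fun s => q s p.2 := by
      filter_upwards [isOpen_Ioo.mem_nhds hpm.1] with s hs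
      rw [hqq (Ioo_subset_Icc_self hs)]
    rw [hloc.deriv_eq, hWW (Ioo_subset_Icc_self hpm.1), hqq (Ioo_subset_Icc_self hpm.1)]
    exact hp
  have hmain := quadratic_entropy_inequality_of_lipschitzWith hT hη hV hVmono
    (hL.comp_projIcc_fst hT.le) hpde' hG hβC1 hβ hφ hφ0
  change entropyE T (fun x => q' 0 x) (fun x => x ^ 2 / 2) β φ q' ≥ _ at hmain
  have hcongr (F : (ℝ → ℝ) → (ℝ → ℝ) → ℝ → ℝ) :
      ∫ t in Ioo (0:ℝ) T, F (q' t) (nonlocalTerm (expKernel η) q' t) t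
        = ∫ t in Ioo (0:ℝ) T, F (q t) (nonlocalTerm (expKernel η) q t) t :=
    setIntegral_congr_fun measurableSet_Ioo fun t ht => by
      simp only [hqq (Ioo_subset_Icc_self ht), hWW (Ioo_subset_Icc_self ht)]
  unfold entropyE at hmain ⊢
  rw [hqq (left_mem_Icc.2 hT.le),
    hcongr fun u _ t => ∫ x, u x ^ 2 / 2 * deriv (fun s => φ s x) t
      + β (u x) * deriv (fun y => φ t y) x,
    hcongr fun u w t => ∫ x, (G |u x| - G (w x)) * deriv (fun y => φ t y) x,
    hcongr fun u w t => ∫ x, (u x ^ 2 - w x ^ 2) * V (w x) * deriv (fun y => φ t y) x,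
    hcongr fun u w t => ∫ x, u x ^ 2 * (V |u x| - V (w x)) * deriv (fun y => φ t y) x] at hmain
  exact hmain

end
end

section
/- (The absolute value of a nonlocal solution solves the sign-restricted nonlocal conservation law.) Let T > 0, η > 0, let V : ℝ → ℝ be locally Lipschitz and nondecreasing, and let q ∈ W^{1,∞}(Ω_T) be a strong solution of the nonlocal conservation law ∂_t q + ∂_x(V(W[q,γ_η])q) = 0 with exponential kernel γ_η and q₀ := q(0,·). Then ρ := |q| is a weak solution of ∂_t ρ + ∂_x(V(W[q,γ_η])ρ) = 0 with initial datum |q₀|; that is, for every test function φ ∈ C¹_c([0,T)×ℝ): ∬_{Ω_T} |q(t,x)|(∂_tφ(t,x) + ∂_xφ(t,x)·V(W[q,γ_η](t,x))) dx dt + ∫_ℝ φ(0,x)|q₀(x)| dx = 0. -/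
open MeasureTheory Set Filter Function

noncomputable section

/-! ### Locally Lipschitz functions -/

lemma LocallyLipschitz.real_mul {α : Type*} [PseudoEMetricSpace α] {f g : α → ℝ}
    (hf : LocallyLipschitz f) (hg : LocallyLipschitz g) :
    LocallyLipschitz (fun p => f p * g p) :=
  (contDiff_mul (𝕜 := ℝ) (𝔸 := ℝ) (n := 1)).locallyLipschitz.comp (hf.prodMk hg)

/-- Integration by parts for a locally Lipschitz function against a `C¹` function. -/
lemma LocallyLipschitz.integral_mul_deriv {f ψ : ℝ → ℝ} (hf : LocallyLipschitz f)
    (hψ : ContDiff ℝ 1 ψ) (a b : ℝ) :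
    ∫ x in a..b, f x * deriv ψ x
      = f b * ψ b - f a * ψ a - ∫ x in a..b, deriv f x * ψ x := by
  have absCont : ∀ {h : ℝ → ℝ}, LocallyLipschitz h → AbsolutelyContinuousOnInterval h a b := by
    intro h hh
    obtain ⟨K, hK⟩ := hh.locallyLipschitzOn.exists_lipschitzOnWith_of_compact
      (isCompact_uIcc (a := a) (b := b))
    exact hK.absolutelyContinuousOnInterval
  exact (absCont hf).integral_mul_deriv_eq_deriv_mul (absCont hψ.locallyLipschitz)

/-- The partial derivative of a locally Lipschitz function, multiplied by a continuous function, is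
integrable on bounded boxes. -/
lemma LocallyLipschitz.integrableOn_deriv_mul {f : ℝ → ℝ → ℝ} (hf : LocallyLipschitz (uncurry f))
    {ψ : ℝ × ℝ → ℝ} (hψ : Continuous ψ) (a b c d : ℝ) :
    IntegrableOn (fun p : ℝ × ℝ => deriv (f p.1) p.2 * ψ p) (Icc a b ×ˢ Icc c d) := by
  obtain ⟨K, hK⟩ := hf.locallyLipschitzOn.exists_lipschitzOnWith_of_compact
    ((isCompact_Icc (a := a) (b := b)).prod (isCompact_Icc (a := c - 1) (b := d + 1)))
  have hbox : MeasurableSet (Icc a b ×ˢ Icc c d) := measurableSet_Icc.prod measurableSet_Icc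
  have hψi : IntegrableOn ψ (Icc a b ×ˢ Icc c d) :=
    hψ.continuousOn.integrableOn_compact (isCompact_Icc.prod isCompact_Icc)
  refine Integrable.bdd_mul (c := K) hψi
    (measurable_deriv_with_param hf.continuous).aestronglyMeasurable ?_
  refine (ae_restrict_iff' hbox).2 (Eventually.of_forall ?_)
  rintro ⟨t, x⟩ ⟨ht, hx⟩
  refine norm_deriv_le_of_lipschitzOn (s := Icc (c - 1) (d + 1))
    (Icc_mem_nhds (by linarith [hx.1]) (by linarith [hx.2])) ?_
  intro y hy z hz
  have := hK (x := (t, y)) ⟨ht, hy⟩ (y := (t, z)) ⟨ht, hz⟩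
  simpa [Prod.edist_eq, uncurry] using this

/-! ### Weak formulation of a conservation law with locally Lipschitz density and flux -/

/-- If `∂ₜ a + ∂ₓ g = 0` almost everywhere, with `a` and `g` locally Lipschitz, then the equation
holds in the weak sense with initial datum `a 0`. -/
lemma weak_formulation_of_locallyLipschitz {T : ℝ} (hT : 0 < T) {a g : ℝ → ℝ → ℝ}
    (ha : LocallyLipschitz (uncurry a)) (hg : LocallyLipschitz (uncurry g))
    (hpde : ∀ᵐ t ∂(volume.restrict (Ioo (0:ℝ) T)), ∀ᵐ x : ℝ,
      deriv (fun s => a s x) t + deriv (g t) x = 0)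
    {φ : ℝ → ℝ → ℝ} (hφ : IsTestFun T φ) :
    (∫ t in Ioo (0:ℝ) T, ∫ x : ℝ,
        (a t x * deriv (fun s => φ s x) t + g t x * deriv (fun y => φ t y) x))
      + (∫ x : ℝ, φ 0 x * a 0 x) = 0 := by
  have hdiff : ∀ p, HasFDerivAt (uncurry φ) (fderiv ℝ (uncurry φ) p) p := fun p =>
    (hφ.smooth.differentiable one_ne_zero p).hasFDerivAt
  have hφt : ∀ t x, deriv (fun s => φ s x) t = fderiv ℝ (uncurry φ) (t, x) (1, 0) := fun t x =>
    (HasFDerivAt.comp_hasDerivAt (l := uncurry φ) t (hdiff (t, x))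
      ((hasDerivAt_id' t).prodMk (hasDerivAt_const t x))).deriv
  have hφx : ∀ t x, deriv (fun y => φ t y) x = fderiv ℝ (uncurry φ) (t, x) (0, 1) := fun t x =>
    ((hdiff (t, x)).comp_hasDerivAt x ((hasDerivAt_const x t).prodMk (hasDerivAt_id' x))).deriv
  have hcont : Continuous (fderiv ℝ (uncurry φ)) := hφ.smooth.continuous_fderiv one_ne_zero
  have hφtc : Continuous (fun p : ℝ × ℝ => deriv (fun s => φ s p.2) p.1) := by
    simp only [hφt]; fun_prop
  have hφxc : Continuous (fun p : ℝ × ℝ => deriv (fun y => φ p.1 y) p.2) := by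
    simp only [hφx]; fun_prop
  have hφc : Continuous (uncurry φ) := hφ.smooth.continuous
  obtain ⟨R₀, hR₀⟩ := hφ.compSupp.isCompact.isBounded.subset_closedBall 0
  set R : ℝ := |R₀| + 1 with hR
  have hRpos : 0 < R := by positivity
  have hout : ∀ t x, R ≤ |x| → (t, x) ∉ tsupport (uncurry φ) := by
    intro t x hx hmem
    have h1 := hR₀ hmem
    rw [mem_closedBall_zero_iff, Prod.norm_def] at h1
    have h2 : |x| ≤ R₀ := (le_max_right _ _).trans h1
    linarith [le_abs_self R₀]
  have hout' : ∀ x, x ∉ Ioc (-R) R → R ≤ |x| := by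
    intro x hx
    by_contra! h
    exact hx ⟨(abs_lt.1 h).1, (abs_lt.1 h).2.le⟩
  have hzero : ∀ t x, R ≤ |x| → φ t x = 0 := fun t x hx =>
    image_eq_zero_of_notMem_tsupport (f := uncurry φ) (hout t x hx)
  have hdzero : ∀ t x, R ≤ |x| → fderiv ℝ (uncurry φ) (t, x) = 0 := fun t x hx =>
    fderiv_of_notMem_tsupport ℝ (hout t x hx)
  set μ := volume.restrict (Ioo (0:ℝ) T) with hμ
  set ν := volume.restrict (Ioc (-R) R) with hν
  have hprod : μ.prod ν ≤ volume.restrict (Icc 0 T ×ˢ Icc (-R) R) := by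
    rw [hμ, hν, Measure.prod_restrict]
    exact Measure.restrict_mono (Set.prod_mono Ioo_subset_Icc_self Ioc_subset_Icc_self) le_rfl
  have hint_cont : ∀ {h : ℝ × ℝ → ℝ}, Continuous h → Integrable h (μ.prod ν) := fun hh =>
    Integrable.mono_measure (hh.continuousOn.integrableOn_compact
      (isCompact_Icc.prod isCompact_Icc)) hprod
  have hac : Continuous (uncurry a) := ha.continuous
  have hgc : Continuous (uncurry g) := hg.continuous
  have i1 : Integrable (fun p : ℝ × ℝ => a p.1 p.2 * deriv (fun s => φ s p.2) p.1) (μ.prod ν) :=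
    hint_cont (hac.mul hφtc)
  have i2 : Integrable (fun p : ℝ × ℝ => g p.1 p.2 * deriv (fun y => φ p.1 y) p.2) (μ.prod ν) :=
    hint_cont (hgc.mul hφxc)
  have i4 : Integrable (fun p : ℝ × ℝ => deriv (g p.1) p.2 * φ p.1 p.2) (μ.prod ν) :=
    Integrable.mono_measure (hg.integrableOn_deriv_mul hφc 0 T (-R) R) hprod
  have i3 : Integrable (fun p : ℝ × ℝ => deriv (fun s => a s p.2) p.1 * φ p.1 p.2)
      (μ.prod ν) := by
    have hswap : LocallyLipschitz (uncurry fun x t => a t x) :=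
      ha.comp (LipschitzWith.prod_snd.locallyLipschitz.prodMk
        LipschitzWith.prod_fst.locallyLipschitz)
    have h := hswap.integrableOn_deriv_mul (hφc.comp continuous_swap) (-R) R 0 T
    have hprod' : ν.prod μ ≤ volume.restrict (Icc (-R) R ×ˢ Icc 0 T) := by
      rw [hμ, hν, Measure.prod_restrict]
      exact Measure.restrict_mono (Set.prod_mono Ioc_subset_Icc_self Ioo_subset_Icc_self) le_rfl
    exact (Integrable.mono_measure h hprod').swap
  have htime : ∀ x, ∫ t, a t x * deriv (fun s => φ s x) t ∂μ
      = -(φ 0 x * a 0 x) - ∫ t, deriv (fun s => a s x) t * φ t x ∂μ := by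
    intro x
    have hlip : LocallyLipschitz (fun s => a s x) := ha.comp (LocallyLipschitz.prodMk_right x)
    have hsm : ContDiff ℝ 1 (fun s => φ s x) :=
      hφ.smooth.comp (contDiff_id.prodMk contDiff_const)
    have h := hlip.integral_mul_deriv hsm 0 T
    rw [intervalIntegral.integral_of_le hT.le, intervalIntegral.integral_of_le hT.le,
      integral_Ioc_eq_integral_Ioo, integral_Ioc_eq_integral_Ioo, hφ.vanish T x le_rfl] at h
    rw [h]
    ring
  have hspace : ∀ t, ∫ x, g t x * deriv (fun y => φ t y) x ∂ν
      = -∫ x, deriv (g t) x * φ t x ∂ν := by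
    intro t
    have hlip : LocallyLipschitz (g t) := hg.comp (LocallyLipschitz.prodMk_left t)
    have hsm : ContDiff ℝ 1 (fun y => φ t y) :=
      hφ.smooth.comp (contDiff_const.prodMk contDiff_id)
    have h := hlip.integral_mul_deriv hsm (-R) R
    rw [intervalIntegral.integral_of_le (by linarith), intervalIntegral.integral_of_le
      (by linarith), hzero t R (le_abs_self R), hzero t (-R) (by simp [abs_of_pos hRpos])] at h
    rw [h]
    ring
  have hcut : ∀ t, ∫ x : ℝ, (a t x * deriv (fun s => φ s x) t + g t x * deriv (fun y => φ t y) x)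
      = ∫ x, (a t x * deriv (fun s => φ s x) t + g t x * deriv (fun y => φ t y) x) ∂ν := by
    intro t
    refine (setIntegral_eq_integral_of_forall_compl_eq_zero fun x hx => ?_).symm
    simp [hφt, hφx, hdzero t x (hout' x hx)]
  have hcut₀ : ∫ x : ℝ, φ 0 x * a 0 x = ∫ x, φ 0 x * a 0 x ∂ν := by
    refine (setIntegral_eq_integral_of_forall_compl_eq_zero fun x hx => ?_).symm
    simp [hzero 0 x (hout' x hx)]
  have hi₀ : Integrable (fun x => φ 0 x * a 0 x) ν := by
    have h : Continuous (fun x => φ 0 x * a 0 x) :=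
      (hφc.comp (Continuous.prodMk_right 0)).mul (hac.comp (Continuous.prodMk_right 0))
    exact (h.continuousOn.integrableOn_compact isCompact_Icc).mono_set Ioc_subset_Icc_self
  have htotal : ∫ p, (a p.1 p.2 * deriv (fun s => φ s p.2) p.1) ∂(μ.prod ν)
      = -(∫ x, φ 0 x * a 0 x ∂ν)
        - ∫ p, deriv (fun s => a s p.2) p.1 * φ p.1 p.2 ∂(μ.prod ν) := by
    rw [integral_prod_symm _ i1, integral_prod_symm _ i3]
    simp only [htime]
    exact (integral_sub hi₀.neg i3.integral_prod_right).trans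
      (congrArg (· - _) (integral_neg _))
  have hspaceTotal : ∫ p, (g p.1 p.2 * deriv (fun y => φ p.1 y) p.2) ∂(μ.prod ν)
      = -∫ p, deriv (g p.1) p.2 * φ p.1 p.2 ∂(μ.prod ν) := by
    rw [integral_prod _ i2, integral_prod _ i4]
    simp only [hspace]
    rw [integral_neg]
  have hvanish : ∫ p, deriv (fun s => a s p.2) p.1 * φ p.1 p.2 ∂(μ.prod ν)
      + ∫ p, deriv (g p.1) p.2 * φ p.1 p.2 ∂(μ.prod ν) = 0 := by
    rw [← integral_add i3 i4]
    refine (integral_prod _ (i3.add i4)).trans (integral_eq_zero_of_ae ?_)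
    filter_upwards [hpde] with t ht
    refine integral_eq_zero_of_ae ?_
    filter_upwards [ae_restrict_of_ae ht] with x hx
    simp [← add_mul, hx]
  simp only [hcut]
  rw [hcut₀, ← integral_prod (fun p : ℝ × ℝ => a p.1 p.2 * deriv (fun s => φ s p.2) p.1
    + g p.1 p.2 * deriv (fun y => φ p.1 y) p.2) (i1.add i2), integral_add i1 i2, htotal,
    hspaceTotal]
  linarith

/-! ### The nonlocal term with exponential kernel -/

lemma expKernel_nonneg {η : ℝ} (hη : 0 < η) (x : ℝ) : 0 ≤ expKernel η x := by
  unfold expKernel; positivity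

lemma integrableOn_expKernel {η : ℝ} (hη : 0 < η) : IntegrableOn (expKernel η) (Iic 0) := by
  have h := (integrableOn_exp_mul_Iic (a := η⁻¹) (inv_pos.2 hη) 0).div_const η
  refine IntegrableOn.congr_fun h (fun x _ => ?_) measurableSet_Iic
  simp [expKernel, div_eq_inv_mul]

/-- The exponential kernel integrates functions of linear growth. -/
lemma integrableOn_expKernel_mul {η : ℝ} (hη : 0 < η) {f : ℝ → ℝ} (hf : Continuous f) {A K : ℝ}
    (hK : 0 ≤ K) (hbound : ∀ z, |f z| ≤ A + K * |z|) :
    IntegrableOn (fun z => expKernel η z * f z) (Iic 0) := by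
  have hdom : IntegrableOn (fun z => (A + K * (2 * η)) / η * Real.exp ((2 * η)⁻¹ * z)) (Iic 0) :=
    (integrableOn_exp_mul_Iic (a := (2 * η)⁻¹) (by positivity) 0).const_mul _
  refine Integrable.mono' hdom ?_ ((ae_restrict_iff' measurableSet_Iic).2
    (Eventually.of_forall fun z hz => ?_))
  · have : Continuous (fun z => expKernel η z * f z) := by unfold expKernel; fun_prop
    exact this.aestronglyMeasurable
  · have hz : z ≤ 0 := hz
    have hA : 0 ≤ A := by simpa using (abs_nonneg _).trans (hbound 0)
    set E := Real.exp ((2 * η)⁻¹ * z) with hE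
    have hEpos : 0 < E := Real.exp_pos _
    have hE1 : E ≤ 1 := Real.exp_le_one_iff.2 (mul_nonpos_of_nonneg_of_nonpos (by positivity) hz)
    have hsq : Real.exp (z / η) = E * E := by
      rw [hE, ← Real.exp_add]
      congr 1
      field_simp
      ring
    have hlin : |z| * E ≤ 2 * η := by
      have h1 := Real.add_one_le_exp (-((2 * η)⁻¹ * z))
      rw [Real.exp_neg, ← hE] at h1
      have h2 : -((2 * η)⁻¹ * z) * E ≤ 1 := by
        calc -((2 * η)⁻¹ * z) * E ≤ E⁻¹ * E := by gcongr; linarith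
          _ = 1 := inv_mul_cancel₀ hEpos.ne'
      rw [abs_of_nonpos hz]
      calc -z * E = 2 * η * (-((2 * η)⁻¹ * z) * E) := by field_simp
        _ ≤ 2 * η * 1 := by gcongr
        _ = 2 * η := mul_one _
    rw [Real.norm_eq_abs, abs_mul, abs_of_nonneg (expKernel_nonneg hη z), expKernel, hsq]
    calc E * E / η * |f z| ≤ E * E / η * (A + K * |z|) := by gcongr; exact hbound z
      _ = E / η * (A * E + K * (|z| * E)) := by ring
      _ ≤ E / η * (A * 1 + K * (2 * η)) := by gcongr
      _ = (A + K * (2 * η)) / η * E := by ring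

/-- The nonlocal term of a Lipschitz function is Lipschitz. -/
lemma lipschitzWith_nonlocalTerm {η : ℝ} (hη : 0 < η) {q : ℝ → ℝ → ℝ} {L : NNReal}
    (hq : LipschitzWith L (uncurry q)) :
    LipschitzWith (L * (∫ z in Iic (0:ℝ), expKernel η z).toNNReal)
      (uncurry (nonlocalTerm (expKernel η) q)) := by
  have habs : ∀ s t x y, |(|q s x| - |q t y|)| ≤ L * max |s - t| |x - y| := by
    intro s t x y
    refine (abs_abs_sub_abs_le_abs_sub _ _).trans ?_
    have := hq.dist_le_mul (s, x) (t, y)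
    simpa [Prod.dist_eq, Real.dist_eq, uncurry] using this
  have hint : ∀ t x, IntegrableOn (fun z => expKernel η z * |q t (z + x)|) (Iic 0) := by
    intro t x
    have hc : Continuous (fun z => |q t (z + x)|) :=
      (hq.continuous.comp (continuous_const.prodMk (continuous_add_const x))).abs
    refine integrableOn_expKernel_mul hη hc (A := |q t x|) (K := L) L.2 fun z => ?_
    have h := habs t t (z + x) x
    rw [sub_self, abs_zero, add_sub_cancel_right, max_eq_right (abs_nonneg z)] at h
    rw [abs_abs]
    linarith [(abs_le.1 h).2]
  have hmass : 0 ≤ ∫ z in Iic (0:ℝ), expKernel η z := integral_nonneg (expKernel_nonneg hη)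
  refine LipschitzWith.of_dist_le_mul ?_
  rintro ⟨s, x⟩ ⟨t, y⟩
  simp only [uncurry, NNReal.coe_mul, Real.coe_toNNReal _ hmass, nonlocalTerm_eq_integral_Iic_zero,
    Prod.dist_eq, Real.dist_eq]
  rw [← integral_sub (hint s x) (hint t y)]
  calc |∫ z in Iic (0:ℝ), (expKernel η z * |q s (z + x)| - expKernel η z * |q t (z + y)|)|
      ≤ ∫ z in Iic (0:ℝ), expKernel η z * (L * max |s - t| |x - y|) := by
        rw [← Real.norm_eq_abs (∫ _ in _, _)]
        refine norm_integral_le_of_norm_le ((integrableOn_expKernel hη).mul_const _)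
          (Eventually.of_forall fun z => ?_)
        rw [← mul_sub, norm_mul, Real.norm_of_nonneg (expKernel_nonneg hη z), Real.norm_eq_abs]
        have h := habs s t (z + x) (z + y)
        rw [add_sub_add_left_eq_sub] at h
        exact mul_le_mul_of_nonneg_left h (expKernel_nonneg hη z)
    _ = L * (∫ z in Iic (0:ℝ), expKernel η z) * max |s - t| |x - y| := by
        rw [integral_mul_const]; ring

/-! ### Derivatives of absolute values -/

/-- At a zero of `f` where `|f|` is differentiable, multiplication of `|f|` by a continuous
function gives a function with vanishing derivative. -/
lemma deriv_mul_abs_of_eq_zero {v f : ℝ → ℝ} {x : ℝ} (hv : ContinuousAt v x)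
    (hd : DifferentiableAt ℝ (fun y => |f y|) x) (h0 : f x = 0) :
    deriv (fun y => v y * |f y|) x = 0 := by
  have hmin : IsLocalMin (fun y => |f y|) x :=
    Eventually.of_forall fun y => by simp [h0]
  have hlo := hd.hasDerivAt.isLittleO
  rw [hmin.deriv_eq_zero] at hlo
  refine HasDerivAt.deriv (hasDerivAt_iff_isLittleO.2 ?_)
  have hprod := (hv.isBigO_one ℝ).mul_isLittleO hlo
  simpa [h0] using hprod

/-- The equation for `q` passes to `|q|`, pointwise. -/
lemma deriv_abs_add_deriv_mul_abs_eq_zero {q v : ℝ → ℝ → ℝ} {t x : ℝ}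
    (hqt : ContinuousAt (fun s => q s x) t) (hqx : ContinuousAt (q t) x)
    (hv : ContinuousAt (v t) x) (hd : DifferentiableAt ℝ (fun y => |q t y|) x)
    (hpde : deriv (fun s => q s x) t + deriv (fun y => v t y * q t y) x = 0) :
    deriv (fun s => |q s x|) t + deriv (fun y => v t y * |q t y|) x = 0 := by
  rcases lt_trichotomy (q t x) 0 with h | h | h
  · have e1 : (fun s => |q s x|) =ᶠ[nhds t] fun s => -q s x := by
      filter_upwards [hqt.eventually_lt_const h] with s hs using abs_of_neg hs
    have e2 : (fun y => v t y * |q t y|) =ᶠ[nhds x] fun y => -(v t y * q t y) := by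
      filter_upwards [hqx.eventually_lt_const h] with y hy
      rw [abs_of_neg hy, mul_neg]
    rw [e1.deriv_eq, e2.deriv_eq, deriv.fun_neg, deriv.fun_neg]
    linarith
  · have hmin : IsLocalMin (fun s => |q s x|) t :=
      Eventually.of_forall fun s => by simp [h]
    rw [hmin.deriv_eq_zero, deriv_mul_abs_of_eq_zero hv hd h, add_zero]
  · have e1 : (fun s => |q s x|) =ᶠ[nhds t] fun s => q s x := by
      filter_upwards [hqt.eventually_const_lt h] with s hs using abs_of_pos hs
    have e2 : (fun y => v t y * |q t y|) =ᶠ[nhds x] fun y => v t y * q t y := by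
      filter_upwards [hqx.eventually_const_lt h] with y hy
      rw [abs_of_pos hy]
    rw [e1.deriv_eq, e2.deriv_eq, hpde]

/-- The statement for solutions that are Lipschitz on the whole plane. -/
lemma abs_weak_formulation_of_lipschitzWith {T : ℝ} (hT : 0 < T) {η : ℝ} (hη : 0 < η)
    {V : ℝ → ℝ} (hV : LocallyLipschitz V) {q : ℝ → ℝ → ℝ} {L : NNReal}
    (hq : LipschitzWith L (uncurry q))
    (hpde : ∀ᵐ t ∂(volume.restrict (Ioo (0:ℝ) T)), ∀ᵐ x : ℝ,
      deriv (fun s => q s x) t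
        + deriv (fun y => V (nonlocalTerm (expKernel η) q t y) * q t y) x = 0)
    {φ : ℝ → ℝ → ℝ} (hφ : IsTestFun T φ) :
    (∫ t in Ioo (0:ℝ) T, ∫ x : ℝ, |q t x| *
        (deriv (fun s => φ s x) t +
          deriv (fun y => φ t y) x * V (nonlocalTerm (expKernel η) q t x)))
      + (∫ x : ℝ, φ 0 x * |q 0 x|) = 0 := by
  set v : ℝ → ℝ → ℝ := fun t x => V (nonlocalTerm (expKernel η) q t x) with hvdef
  have hv : LocallyLipschitz (uncurry v) :=
    hV.comp (lipschitzWith_nonlocalTerm hη hq).locallyLipschitz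
  have ha : LipschitzWith (1 * L) (uncurry fun t x => |q t x|) :=
    LipschitzWith.comp (g := uncurry q) lipschitzWith_one_norm hq
  have h := weak_formulation_of_locallyLipschitz hT (a := fun t x => |q t x|)
    (g := fun t x => v t x * |q t x|) ha.locallyLipschitz (hv.real_mul ha.locallyLipschitz)
    ?_ hφ
  · refine Eq.trans ?_ h
    congr 1
    congr 1 with t
    congr 1 with x
    ring
  · filter_upwards [hpde] with t ht
    have hat : LipschitzWith (1 * L * 1) (fun y => |q t y|) :=
      LipschitzWith.comp ha (LipschitzWith.prodMk_left t)
    filter_upwards [ht, hat.ae_differentiableAt_real] with x hx hdx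
    exact deriv_abs_add_deriv_mul_abs_eq_zero
      (hq.continuous.comp (Continuous.prodMk_left x)).continuousAt
      (hq.continuous.comp (Continuous.prodMk_right t)).continuousAt
      (hv.continuous.comp (Continuous.prodMk_right t)).continuousAt hdx hx

/-- the absolute value of a strong nonlocal solution is a weak
solution of the sign-restricted nonlocal conservation law, with the same
nonlocal velocity `V(W[q,γ_η])` and initial datum `|q₀|`. -/
theorem abs_of_solution_solves_sign_restricted
    (T : ℝ) (hT : 0 < T) (η : ℝ) (hη : 0 < η)
    (V : ℝ → ℝ) (hV : LocallyLipschitz V) (hVmono : Monotone V)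
    (q : ℝ → ℝ → ℝ)
    (hq : IsStrongSolutionNonlocal T V (expKernel η) (fun x => q 0 x) q) :
    ∀ φ : ℝ → ℝ → ℝ, IsTestFun T φ →
      (∫ t in Ioo (0:ℝ) T, ∫ x : ℝ, |q t x| *
          (deriv (fun s => φ s x) t +
            deriv (fun y => φ t y) x * V (nonlocalTerm (expKernel η) q t x)))
        + (∫ x : ℝ, φ 0 x * |q 0 x|) = 0 := by
  intro φ hφ
  obtain ⟨⟨L, hL⟩, -, hpde⟩ := hq
  -- extend `q` to the whole plane by projecting time onto `[0, T]`
  set q' : ℝ → ℝ → ℝ := fun t x => q (projIcc 0 T hT.le t) x with hq'def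
  have hqq' : ∀ t ∈ Icc (0:ℝ) T, q' t = q t := fun t ht => by
    simp only [hq'def, projIcc_of_mem hT.le ht]
  have hq' : LipschitzWith L (uncurry q') := by
    have hproj : LipschitzWith 1 (fun p : ℝ × ℝ => ((projIcc 0 T hT.le p.1 : ℝ), p.2)) := by
      refine LipschitzWith.of_dist_le_mul fun p p' => ?_
      have h := (LipschitzWith.projIcc hT.le).dist_le_mul p.1 p'.1
      simp only [NNReal.coe_one, one_mul, Prod.dist_eq] at h ⊢
      exact max_le_max h le_rfl
    have h := hL.comp (hproj.lipschitzOnWith (s := univ))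
      (fun p _ => ⟨(projIcc 0 T hT.le p.1).2, mem_univ _⟩)
    rw [lipschitzOnWith_univ, mul_one] at h
    exact h
  have hW : ∀ t ∈ Icc (0:ℝ) T, nonlocalTerm (expKernel η) q' t = nonlocalTerm (expKernel η) q t :=
    fun t ht => by
      funext x
      simp only [nonlocalTerm, hqq' t ht]
  have hpde' : ∀ᵐ t ∂(volume.restrict (Ioo (0:ℝ) T)), ∀ᵐ x : ℝ,
      deriv (fun s => q' s x) t
        + deriv (fun y => V (nonlocalTerm (expKernel η) q' t y) * q' t y) x = 0 := by
    rw [Measure.volume_eq_prod, ← Measure.prod_restrict, Measure.restrict_univ] at hpde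
    filter_upwards [Measure.ae_ae_of_ae_prod hpde, ae_restrict_mem measurableSet_Ioo] with t ht htm
    filter_upwards [ht] with x hx
    have e : (fun s => q' s x) =ᶠ[nhds t] fun s => q s x := by
      filter_upwards [Icc_mem_nhds htm.1 htm.2] with s hs
      rw [hqq' s hs]
    rw [e.deriv_eq, hW t (Ioo_subset_Icc_self htm), hqq' t (Ioo_subset_Icc_self htm)]
    exact hx
  have h := abs_weak_formulation_of_lipschitzWith hT hη hV hq' hpde' hφ
  rw [hqq' 0 (left_mem_Icc.2 hT.le)] at h
  refine Eq.trans ?_ h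
  congr 1
  refine setIntegral_congr_fun measurableSet_Ioo fun t ht => ?_
  simp only [hqq' t (Ioo_subset_Icc_self ht), hW t (Ioo_subset_Icc_self ht)]

end
end
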